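/- arXiv:1302.5692 — 2 statements merged into one kernel-verified Lean document; each statement's English description precedes it below -/
import Mathlib

section
/- Let 𝒰 be a strict Fraïssé class, let T be a countable structure whose age is contained in 𝒰, and let 𝒞 ⊆ 𝒰 be a Fraïssé class that is free in 𝒰. Then there exists a universal homogeneous homomorphism u : U → T within 𝒞̄. Moreover, if û : Û → T is another universal homogeneous homomorphism within 𝒞̄, then there exists an isomorphism h : Û → U such that û = u ∘ h. -/
universe u v w

open FirstOrder FirstOrder.Language CategoryTheory

namespace UHomog

variable (L : FirstOrder.Language.{u, v})

/-- The class `𝒞̄` of countable structures whose age is contained in `K`. -/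
def InBar (K : Set (Bundled.{w} L.Structure)) (A : Type w) [L.Structure A] : Prop :=
  Countable A ∧ L.age A ⊆ K

/-- A homomorphism `u : U → T` is universal within `𝒞̄ = K̄` if every homomorphism from a member
of `K̄` to `T` factors through an embedding into `U`. -/
def IsUniversalHom (K : Set (Bundled.{w} L.Structure)) {U T : Type w}
    [L.Structure U] [L.Structure T] (u : U →[L] T) : Prop :=
  ∀ A : Bundled.{w} L.Structure, InBar L K A → ∀ h : A →[L] T,
    ∃ ι : A ↪[L] U, ∀ a : A, u (ι a) = h a

/-- A homomorphism `u : U → T` is homogeneous if every embedding of a finitely generated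
substructure of `U` into `U` compatible with `u` extends to an automorphism of `U` compatible
with `u`. -/
def IsHomogeneousHom {U T : Type w} [L.Structure U] [L.Structure T] (u : U →[L] T) : Prop :=
  ∀ S : L.Substructure U, S.FG → ∀ ι : S ↪[L] U,
    (∀ s : S, u (ι s) = u s) →
    ∃ α : U ≃[L] U, (∀ x : U, u (α x) = u x) ∧ ∀ s : S, α s = ι s

/-- An age: a class of finitely generated structures with countably many isomorphism types,
closed under isomorphism, with the hereditary property and the joint embedding property. -/
def IsAge (K : Set (Bundled.{w} L.Structure)) : Prop :=
  K.Nonempty ∧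
  (∀ M : Bundled.{w} L.Structure, M ∈ K → Structure.FG L M) ∧
  (∀ M N : Bundled.{w} L.Structure, Nonempty (M ≃[L] N) → (M ∈ K ↔ N ∈ K)) ∧
  (∃ S : Set (Bundled.{w} L.Structure), S.Countable ∧
    ∀ M ∈ K, ∃ N ∈ S, Nonempty (M ≃[L] N)) ∧
  Hereditary K ∧ JointEmbedding K

/-- The square `g₁ ∘ f₁ = g₂ ∘ f₂` is a pushout square in the category of countable structures
with age contained in `K`, with homomorphisms as morphisms. -/
def IsPushoutSquare (K : Set (Bundled.{w} L.Structure)) {A B₁ B₂ C : Type w}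
    [L.Structure A] [L.Structure B₁] [L.Structure B₂] [L.Structure C]
    (f₁ : A ↪[L] B₁) (f₂ : A ↪[L] B₂) (g₁ : B₁ →[L] C) (g₂ : B₂ →[L] C) : Prop :=
  g₁.comp f₁.toHom = g₂.comp f₂.toHom ∧
  ∀ D : Bundled.{w} L.Structure, InBar L K D → ∀ (k₁ : B₁ →[L] D) (k₂ : B₂ →[L] D),
    k₁.comp f₁.toHom = k₂.comp f₂.toHom →
    ∃! m : C →[L] D, m.comp g₁ = k₁ ∧ m.comp g₂ = k₂

/-- A strict Fraïssé class: a Fraïssé class in which every span of embeddings can be completed to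
a canonical (pushout) amalgam. -/
def IsStrictFraisse (K : Set (Bundled.{w} L.Structure)) : Prop :=
  IsFraisse K ∧
  ∀ A B₁ B₂ : Bundled.{w} L.Structure, A ∈ K → B₁ ∈ K → B₂ ∈ K →
    ∀ (f₁ : A ↪[L] B₁) (f₂ : A ↪[L] B₂),
      ∃ (C : Bundled.{w} L.Structure) (g₁ : B₁ →[L] C) (g₂ : B₂ →[L] C),
        C ∈ K ∧ IsPushoutSquare L K f₁ f₂ g₁ g₂

/-- A Fraïssé class `K₀` is free in the strict Fraïssé class `K` if it is closed with respect to
canonical (pushout) amalgams in `K`. -/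
def IsFreeIn (K₀ K : Set (Bundled.{w} L.Structure)) : Prop :=
  K₀ ⊆ K ∧
  ∀ A B₁ B₂ : Bundled.{w} L.Structure, A ∈ K₀ → B₁ ∈ K₀ → B₂ ∈ K₀ →
    ∀ (f₁ : A ↪[L] B₁) (f₂ : A ↪[L] B₂),
      ∃ (C : Bundled.{w} L.Structure) (g₁ : B₁ →[L] C) (g₂ : B₂ →[L] C),
        C ∈ K₀ ∧ IsPushoutSquare L K f₁ f₂ g₁ g₂

/-- The amalgamated extension property. -/
def AmalgamatedExtension (K : Set (Bundled.{w} L.Structure)) : Prop :=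
  ∀ A B₁ B₂ T : Bundled.{w} L.Structure, A ∈ K → B₁ ∈ K → B₂ ∈ K → T ∈ K →
    ∀ (f₁ : A ↪[L] B₁) (f₂ : A ↪[L] B₂) (h₁ : B₁ →[L] T) (h₂ : B₂ →[L] T),
      h₁.comp f₁.toHom = h₂.comp f₂.toHom →
      ∃ (C T' : Bundled.{w} L.Structure) (g₁ : B₁ ↪[L] C) (g₂ : B₂ ↪[L] C)
        (k : T ↪[L] T') (h : C →[L] T'),
        C ∈ K ∧ T' ∈ K ∧ g₁.comp f₁ = g₂.comp f₂ ∧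
        h.comp g₁.toHom = k.toHom.comp h₁ ∧ h.comp g₂.toHom = k.toHom.comp h₂

/-- The homo amalgamation property (HAP). -/
def HAP (K : Set (Bundled.{w} L.Structure)) : Prop :=
  ∀ A B₁ B₂ : Bundled.{w} L.Structure, A ∈ K → B₁ ∈ K → B₂ ∈ K →
    ∀ (f₁ : A ↪[L] B₁) (f₂ : A →[L] B₂),
      ∃ (C : Bundled.{w} L.Structure) (g₁ : B₁ →[L] C) (g₂ : B₂ ↪[L] C),
        C ∈ K ∧ g₁.comp f₁.toHom = g₂.toHom.comp f₂

/-- A homomorphism `r : A → B` is a retraction if it has a section. -/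
def IsRetraction {A B : Type w} [L.Structure A] [L.Structure B] (r : A →[L] B) : Prop :=
  ∃ ι : B →[L] A, ∀ b : B, r (ι b) = b

end UHomog

namespace UHomog

variable {L : FirstOrder.Language.{u, v}} {K : Set (Bundled.{w} L.Structure)}

/-! ### Existence of Fraïssé limits -/

/-- An essentially countable nonempty class has a countable sequence of representatives. -/
theorem exists_representatives (hK : IsFraisse K) :
    ∃ S : ℕ → Bundled.{w} L.Structure, (∀ n, S n ∈ K) ∧
      ∀ N ∈ K, ∃ n, Nonempty (N ≃[L] S n) := by
  obtain ⟨F, hF⟩ := hK.is_essentially_countable.exists_eq_range (hK.is_nonempty.image _)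
  have hmem : ∀ n, ∃ N ∈ K, Quotient.mk' N = F n := fun n =>
    (Set.ext_iff.1 hF (F n)).2 ⟨n, rfl⟩
  choose S hSK hS using hmem
  refine ⟨S, hSK, fun N hN => ?_⟩
  obtain ⟨n, hn⟩ := (Set.ext_iff.1 hF (Quotient.mk' N)).1 ⟨N, hN, rfl⟩
  exact ⟨n, Quotient.exact (hn.symm.trans (hS n).symm)⟩

/-- An extension problem over `N`: an embedding between two members of the family `S`
together with an embedding of its domain into `N`. -/
abbrev ExtensionProblem (S : ℕ → Bundled.{w} L.Structure) (N : Type w) [L.Structure N] :=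
  Σ p : ℕ × ℕ, (S p.1 ↪[L] S p.2) × (S p.1 ↪[L] N)

/-- Transport of an extension problem along an embedding. -/
def ExtensionProblem.push {S : ℕ → Bundled.{w} L.Structure} {N P : Type w} [L.Structure N]
    [L.Structure P] (e : N ↪[L] P) (t : ExtensionProblem S N) : ExtensionProblem S P :=
  ⟨t.1, t.2.1, e.comp t.2.2⟩

theorem exists_solution (hK : IsFraisse K) {S : ℕ → Bundled.{w} L.Structure}
    (hS : ∀ n, S n ∈ K) (N : K) (t : Option (ExtensionProblem S N.1)) :
    ∃ (Q : K) (e : N.1 ↪[L] Q.1), ∀ t' ∈ t, ∃ g : S t'.1.2 ↪[L] Q.1,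
      g.comp t'.2.1 = e.comp t'.2.2 := by
  cases t with
  | none => exact ⟨N, Embedding.refl L _, by simp⟩
  | some t =>
    obtain ⟨Q, g, e, hQ, h⟩ := hK.amalgamation _ _ _ t.2.1 t.2.2 (hS _) (hS _) N.2
    refine ⟨⟨Q, hQ⟩, e, fun t' ht => ?_⟩
    obtain rfl : t = t' := by simpa using ht
    exact ⟨g, h⟩

theorem exists_enumeration [Countable (Σ l, L.Functions l)] (hK : IsFraisse K)
    {S : ℕ → Bundled.{w} L.Structure} (hS : ∀ n, S n ∈ K) (N : K) :
    ∃ c : ℕ → Option (ExtensionProblem S N.1), ∀ t, ∃ k, c k = some t := by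
  have hFG : ∀ n, Structure.FG L (S n) := fun n => hK.FG _ (hS n)
  have hc : ∀ P ∈ K, Countable P := fun P hP =>
    Structure.cg_iff_countable.1 (hK.FG P hP).cg
  have := hc N.1 N.2
  have := fun n => hc _ (hS n)
  obtain ⟨c, hc⟩ := exists_surjective_nat (Option (ExtensionProblem S N.1))
  exact ⟨c, fun t => hc _⟩

theorem natLERec_self {G : ℕ → Type w} [∀ n, L.Structure (G n)] (f : ∀ n, G n ↪[L] G (n + 1))
    (i : ℕ) : DirectedSystem.natLERec f i i le_rfl = Embedding.refl L (G i) :=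
  Nat.leRecOn_self _

theorem natLERec_succ {G : ℕ → Type w} [∀ n, L.Structure (G n)] (f : ∀ n, G n ↪[L] G (n + 1))
    {i m : ℕ} (h : i ≤ m) : DirectedSystem.natLERec f i (m + 1) (h.trans m.le_succ) =
      (f m).comp (DirectedSystem.natLERec f i m h) :=
  Nat.leRecOn_succ h _

/-- In a Fraïssé class there is a chain along which every extension problem is eventually
solved. -/
theorem exists_rich_chain [Countable (Σ l, L.Functions l)] (hK : IsFraisse K) :
    ∃ (G : ℕ → Bundled.{w} L.Structure) (f : ∀ n, G n ↪[L] G (n + 1)), (∀ n, G n ∈ K) ∧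
      ∀ (i : ℕ) (A B : Bundled.{w} L.Structure), A ∈ K → B ∈ K →
        ∀ (a : A ↪[L] B) (e : A ↪[L] G i), ∃ (j : ℕ) (h : i ≤ j) (g : B ↪[L] G j),
          g.comp a = (DirectedSystem.natLERec f i j h).comp e := by
  obtain ⟨S, hSK, hS⟩ := exists_representatives hK
  choose Q e hQ using exists_solution hK hSK
  choose c hc using exists_enumeration hK hSK
  obtain ⟨N₀, hN₀⟩ := hK.is_nonempty
  let State := Σ N : K, ℕ → ℕ → Option (ExtensionProblem S N.1)
  let next (n : ℕ) (σ : State) : Option (ExtensionProblem S σ.1.1) := σ.2 n.unpair.1 n.unpair.2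
  let step (n : ℕ) (σ : State) : State :=
    ⟨Q σ.1 (next n σ), fun i k =>
      if i = n + 1 then c _ k else (σ.2 i k).map (ExtensionProblem.push (e σ.1 (next n σ)))⟩
  let σ : ℕ → State := fun n => Nat.rec ⟨⟨N₀, hN₀⟩, fun _ => c _⟩ step n
  let G : ℕ → Bundled.{w} L.Structure := fun n => (σ n).1.1
  let f : ∀ n, G n ↪[L] G (n + 1) := fun n => e (σ n).1 (next n (σ n))
  have hdiag : ∀ n, (σ n).2 n = c (σ n).1 := by
    intro n
    cases n with
    | zero => rfl
    | succ n => funext k; exact if_pos rfl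
  have hpush : ∀ i k m (h : i ≤ m), (σ m).2 i k =
      (c (σ i).1 k).map (ExtensionProblem.push (DirectedSystem.natLERec f i m h)) := by
    intro i k m h
    induction m, h using Nat.le_induction with
    | base =>
      rw [hdiag, natLERec_self]
      exact (Option.map_id_apply ..).symm
    | succ m h ih =>
      have : (σ (m + 1)).2 i k = ((σ m).2 i k).map (ExtensionProblem.push (f m)) :=
        if_neg (by omega)
      rw [this, ih, Option.map_map, natLERec_succ f h]
      rfl
  refine ⟨G, f, fun n => (σ n).1.2, fun i A B hA hB a e₀ => ?_⟩
  obtain ⟨p, ⟨α⟩⟩ := hS A hA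
  obtain ⟨q, ⟨β⟩⟩ := hS B hB
  let t : ExtensionProblem S (G i) := ⟨(p, q), (β.toEmbedding.comp a).comp α.symm.toEmbedding,
    e₀.comp α.symm.toEmbedding⟩
  obtain ⟨k, hk⟩ := hc (σ i).1 t
  have him : i ≤ Nat.pair i k := Nat.left_le_pair i k
  have hnext : next (Nat.pair i k) (σ (Nat.pair i k)) =
      some (ExtensionProblem.push (DirectedSystem.natLERec f i _ him) t) := by
    have := hpush i k _ him
    rw [hk] at this
    simpa [next] using this
  obtain ⟨g, hg⟩ : ∃ g : S q ↪[L] G (Nat.pair i k + 1), ∀ y, g (β (a (α.symm y))) =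
      f _ (DirectedSystem.natLERec f i _ him (e₀ (α.symm y))) := by
    obtain ⟨g, hg⟩ := hQ _ _ _ hnext
    exact ⟨g, Embedding.ext_iff.1 hg⟩
  refine ⟨Nat.pair i k + 1, him.trans (Nat.le_succ _), g.comp β.toEmbedding, ?_⟩
  rw [natLERec_succ f him]
  ext x
  have hx := hg (α x)
  rw [Language.Equiv.symm_apply_apply] at hx
  exact hx

/-- An embedding of a finitely generated structure into a direct limit factors through a
component. -/
theorem exists_factor_directLimit {G : ℕ → Type w} [∀ n, L.Structure (G n)]
    (f : ∀ i j, i ≤ j → G i ↪[L] G j) [DirectedSystem G fun i j h => f i j h]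
    {A : Type w} [L.Structure A] (hA : Structure.FG L A) (e : A ↪[L] Language.DirectLimit G f) :
    ∃ (i : ℕ) (e' : A ↪[L] G i), (DirectLimit.of L ℕ G f i).comp e' = e := by
  obtain ⟨i, P, hP⟩ :=
    DirectLimit.exists_fg_substructure_in_Sigma e.toHom.range (hA.range e.toHom)
  have hle : e.toHom.range ≤ (DirectLimit.of L ℕ G f i).toHom.range := by
    rw [← hP]
    rintro _ ⟨y, -, rfl⟩
    exact ⟨y, rfl⟩
  refine ⟨i, (DirectLimit.of L ℕ G f i).equivRange.symm.toEmbedding.comp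
    ((Substructure.inclusion hle).comp e.equivRange.toEmbedding), ?_⟩
  ext x
  have := congrArg Subtype.val ((DirectLimit.of L ℕ G f i).equivRange.apply_symm_apply
    (Substructure.inclusion hle (e.equivRange x)))
  rw [Embedding.equivRange_apply] at this
  exact this

theorem closure_empty_eq_top {M : Type w} [L.Structure M] :
    Substructure.closure L (∅ : Set (Substructure.closure L (∅ : Set M))) = ⊤ := by
  let Z := Substructure.closure L (∅ : Set M)
  apply Substructure.map_injective_of_injective (f := Z.subtype.toHom) Z.subtype.injective
  rw [← Substructure.closure_image, Set.image_empty, ← Hom.range_eq_map,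
    Substructure.range_subtype]

/-- If `N` embeds into a structure containing a copy of the substructure of `M` generated by the
constants, then that substructure embeds into `N`. -/
theorem exists_embedding_closure_empty {M N Q : Type w} [L.Structure M] [L.Structure N]
    [L.Structure Q] (f : (Substructure.closure L (∅ : Set M)) ↪[L] Q) (g : N ↪[L] Q) :
    Nonempty ((Substructure.closure L (∅ : Set M)) ↪[L] N) := by
  have hle : f.toHom.range ≤ g.toHom.range := by
    rw [Hom.range_eq_map, ← closure_empty_eq_top, ← Substructure.closure_image, Set.image_empty]
    exact Substructure.closure_le.2 (Set.empty_subset _)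
  exact ⟨g.equivRange.symm.toEmbedding.comp
    ((Substructure.inclusion hle).comp f.equivRange.toEmbedding)⟩

/-- Every Fraïssé class has a countable limit into which all embeddings of members extend. -/
theorem exists_countable_extension_property [Countable (Σ l, L.Functions l)]
    (hK : IsFraisse K) :
    ∃ M : Bundled.{w} L.Structure, Countable M ∧ L.age M ⊆ K ∧
      ∀ A B : Bundled.{w} L.Structure, A ∈ K → B ∈ K → ∀ (a : A ↪[L] B) (e : A ↪[L] M),
        ∃ g : B ↪[L] M, g.comp a = e := by
  obtain ⟨G, f, hG, hext⟩ := exists_rich_chain hK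
  let F : ∀ i j, i ≤ j → G i ↪[L] G j := DirectedSystem.natLERec f
  have : DirectedSystem (fun n => (G n : Type w)) fun i j h => F i j h :=
    DirectedSystem.natLERec.directedSystem f
  refine ⟨Bundled.of (Language.DirectLimit (fun n => (G n : Type w)) F), ?_, ?_, ?_⟩
  · exact Structure.cg_iff_countable.1 (DirectLimit.cg F fun n => (hK.FG _ (hG n)).cg)
  · refine (age_directLimit (fun n => (G n : Type w)) F).trans_subset ?_
    exact Set.iUnion_subset fun n => hK.hereditary _ (hG n)
  · intro A B hA hB a e
    obtain ⟨i, e', rfl⟩ := exists_factor_directLimit F (hK.FG A hA) e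
    obtain ⟨j, hij, g, hg⟩ := hext i A B hA hB a e'
    refine ⟨(DirectLimit.of L ℕ (fun n => (G n : Type w)) F j).comp g, ?_⟩
    refine Embedding.ext fun x => ?_
    have hx : g (a x) = F i j hij (e' x) := Embedding.ext_iff.1 hg x
    exact (congrArg (DirectLimit.of L ℕ (fun n => (G n : Type w)) F j) hx).trans DirectLimit.of_f

/-- A structure whose age lies in `K` forms an extension pair with any structure having the
extension property for `K`. -/
theorem isExtensionPair_of_extension_property {M N : Type w} [L.Structure M] [L.Structure N]
    (hN : L.age N ⊆ K)
    (hM : ∀ A B : Bundled.{w} L.Structure, A ∈ K → B ∈ K → ∀ (a : A ↪[L] B) (e : A ↪[L] M),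
        ∃ g : B ↪[L] M, g.comp a = e) : L.IsExtensionPair N M := by
  rw [isExtensionPair_iff_exists_embedding_closure_singleton_sup]
  intro S hS f m
  obtain ⟨g, hg⟩ := hM (Bundled.of S)
    (Bundled.of (Substructure.closure L {m} ⊔ S : L.Substructure N))
    (hN (age.fg_substructure hS))
    (hN (age.fg_substructure ((Substructure.fg_closure_singleton m).sup hS)))
    (Substructure.inclusion le_sup_right) f
  exact ⟨g, hg.symm⟩

/-- Every Fraïssé class has a Fraïssé limit, and the limit absorbs all countable structures whose
age lies in the class. -/
theorem exists_isFraisseLimit [Countable (Σ l, L.Functions l)] (hK : IsFraisse K) :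
    ∃ (M : Bundled.{w} L.Structure) (_ : Countable M), IsFraisseLimit K M ∧
      ∀ N : Bundled.{w} L.Structure, Countable N → L.age N ⊆ K → Nonempty (N ↪[L] M) := by
  obtain ⟨M, hMc, hMage, hM⟩ := exists_countable_extension_property hK
  have hMcg : Structure.CG L M := Structure.cg_iff_countable.2 hMc
  have habs : ∀ N : Bundled.{w} L.Structure, Countable N → L.age N ⊆ K →
      Nonempty (N ↪[L] M) := by
    intro N hN hNage
    let Z : L.Substructure N := Substructure.closure L ∅
    have hZ : Z.FG := Substructure.fg_closure Set.finite_empty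
    let Y : L.Substructure M := Substructure.closure L ∅
    have hY : Y.FG := Substructure.fg_closure Set.finite_empty
    obtain ⟨Q, hQ, ⟨f⟩, ⟨g⟩⟩ := hK.jointEmbedding _ (hNage (age.fg_substructure hZ))
      _ (hMage (age.fg_substructure hY))
    obtain ⟨e⟩ := exists_embedding_closure_empty f g
    obtain ⟨h, -⟩ := embedding_from_cg (Structure.cg_iff_countable.2 hN)
      ⟨⟨Z, _, (Y.subtype.comp e).equivRange⟩, hZ⟩ (isExtensionPair_of_extension_property hNage hM)
    exact ⟨h⟩
  refine ⟨M, hMc, ⟨?_, ?_⟩, habs⟩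
  · exact (isUltrahomogeneous_iff_IsExtensionPair hMcg).2
      (isExtensionPair_of_extension_property hMage hM)
  · refine hMage.antisymm fun N hN => ⟨hK.FG N hN, habs N ?_ (hK.hereditary N hN)⟩
    exact Structure.cg_iff_countable.1 (hK.FG N hN).cg

end UHomog

namespace UHomog

variable {L : FirstOrder.Language.{u, v}} {T : Type w}

/-! ### Structures over `T` as structures in an expanded language -/

/-- The expansion of `L` by a relation symbol of each arity for every point of `T`, used to encode
a homomorphism to `T`. -/
def overLanguage (L : FirstOrder.Language.{u, v}) (T : Type w) :
    FirstOrder.Language.{u, max v w} where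
  Functions := L.Functions
  Relations n := L.Relations n ⊕ T

instance [h : Countable (Σ l, L.Functions l)] :
    Countable (Σ l, (overLanguage L T).Functions l) := h

variable [L.Structure T]

/-- The structure on `A` in the expanded language extends the `L`-structure and encodes the
homomorphism `h : A → T`. -/
structure Encodes {A : Type w} [L.Structure A] [(overLanguage L T).Structure A]
    (h : A →[L] T) : Prop where
  funMap_eq : ∀ {n} (F : L.Functions n) (x : Fin n → A),
    Structure.funMap (L := overLanguage L T) F x = Structure.funMap (L := L) F x
  relMap_inl : ∀ {n} (R : L.Relations n) (x : Fin n → A),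
    Structure.RelMap (L := overLanguage L T) (Sum.inl R) x ↔ Structure.RelMap R x
  relMap_inr : ∀ {n} (t : T) (x : Fin n → A),
    Structure.RelMap (L := overLanguage L T) (n := n) (Sum.inr t) x ↔ ∀ i, h (x i) = t

/-- The structure in the expanded language encoding a homomorphism to `T`. -/
abbrev encode {A : Type w} [L.Structure A] (h : A →[L] T) : (overLanguage L T).Structure A where
  funMap {_} F x := Structure.funMap (L := L) F x
  RelMap {_} R x := Sum.elim (fun R => Structure.RelMap (L := L) R x) (fun t => ∀ i, h (x i) = t) R

theorem encodes_encode {A : Type w} [L.Structure A] (h : A →[L] T) :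
    letI := encode h
    Encodes h :=
  letI := encode h
  ⟨fun _ _ => rfl, fun _ _ => Iff.rfl, fun _ _ => Iff.rfl⟩

/-- The `L`-reduct of a structure in the expanded language. -/
abbrev decode (L : FirstOrder.Language.{u, v}) (T A : Type w)
    [(overLanguage L T).Structure A] : L.Structure A where
  funMap {_} F x := Structure.funMap (L := overLanguage L T) F x
  RelMap {_} R x := Structure.RelMap (L := overLanguage L T) (Sum.inl R) x

theorem Encodes.decode_eq {A : Type w} [s : L.Structure A] [(overLanguage L T).Structure A]
    {h : A →[L] T} (hA : Encodes h) : decode L T A = s := by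
  ext n F x
  · exact hA.funMap_eq F x
  · exact hA.relMap_inl F x

section Maps

variable {A B : Type w} [L.Structure A] [L.Structure B] [(overLanguage L T).Structure A]
  [(overLanguage L T).Structure B] {h : A →[L] T} {k : B →[L] T}

theorem Encodes.hom_eq_iff (hA : Encodes h) (a : A) (t : T) :
    h a = t ↔ Structure.RelMap (L := overLanguage L T) (n := 1) (Sum.inr t) fun _ => a := by
  simp [hA.relMap_inr]

/-- An embedding over `T` is an embedding in the expanded language. -/
def Encodes.liftEmbedding (hA : Encodes h) (hB : Encodes k) (e : A ↪[L] B)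
    (he : ∀ a, k (e a) = h a) : A ↪[overLanguage L T] B where
  toEmbedding := e.toEmbedding
  map_fun' {n} F x := by
    rw [hA.funMap_eq F x, hB.funMap_eq F]
    exact e.map_fun F x
  map_rel' {n} R x := by
    rcases R with R | t
    · rw [hA.relMap_inl R x, hB.relMap_inl R]
      exact e.map_rel R x
    · rw [hA.relMap_inr t x, hB.relMap_inr t]
      exact forall_congr' fun i => by rw [← he (x i)]; rfl

/-- An embedding in the expanded language is an embedding of `L`-structures. -/
def Encodes.lowerEmbedding (hA : Encodes h) (hB : Encodes k) (e : A ↪[overLanguage L T] B) :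
    A ↪[L] B where
  toEmbedding := e.toEmbedding
  map_fun' {n} F x := by
    rw [← hA.funMap_eq F x, ← hB.funMap_eq F]
    exact e.map_fun (L := overLanguage L T) F x
  map_rel' {n} R x := by
    rw [← hA.relMap_inl R x, ← hB.relMap_inl R]
    exact e.map_rel (L := overLanguage L T) (Sum.inl R) x

theorem Encodes.hom_apply_embedding (hA : Encodes h) (hB : Encodes k)
    (e : A ↪[overLanguage L T] B) (a : A) : k (e a) = h a := by
  refine (hB.hom_eq_iff _ _).2 ?_
  exact (e.map_rel (L := overLanguage L T) (n := 1) (Sum.inr (h a)) _).2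
    ((hA.hom_eq_iff a (h a)).1 rfl)

/-- An isomorphism over `T` is an isomorphism in the expanded language. -/
def Encodes.liftEquiv (hA : Encodes h) (hB : Encodes k) (e : A ≃[L] B)
    (he : ∀ a, k (e a) = h a) : A ≃[overLanguage L T] B where
  toEquiv := e.toEquiv
  map_fun' := (hA.liftEmbedding hB e.toEmbedding he).map_fun'
  map_rel' := (hA.liftEmbedding hB e.toEmbedding he).map_rel'

/-- An isomorphism in the expanded language is an isomorphism of `L`-structures. -/
def Encodes.lowerEquiv (hA : Encodes h) (hB : Encodes k) (e : A ≃[overLanguage L T] B) :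
    A ≃[L] B where
  toEquiv := e.toEquiv
  map_fun' := (hA.lowerEmbedding hB e.toEmbedding).map_fun'
  map_rel' := (hA.lowerEmbedding hB e.toEmbedding).map_rel'

theorem Encodes.fg_iff (hA : Encodes h) :
    Structure.FG (overLanguage L T) A ↔ Structure.FG L A := by
  rw [Structure.fg_iff, Structure.fg_iff]
  refine exists_congr fun s => and_congr_right fun _ => ?_
  constructor
  · intro hs
    let S : (overLanguage L T).Substructure A :=
      ⟨Substructure.closure L s, fun {n} F x hx => by
        rw [hA.funMap_eq F x]
        exact (Substructure.closure L s).fun_mem F x hx⟩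
    have hS : Substructure.closure (overLanguage L T) s ≤ S :=
      Substructure.closure_le.2 Substructure.subset_closure
    exact eq_top_iff.2 fun a _ => hS (hs ▸ Substructure.mem_top a)
  · intro hs
    let S : L.Substructure A :=
      ⟨Substructure.closure (overLanguage L T) s, fun {n} F x hx => by
        rw [← hA.funMap_eq F x]
        exact (Substructure.closure (overLanguage L T) s).fun_mem F x hx⟩
    have hS : Substructure.closure L s ≤ S :=
      Substructure.closure_le.2 Substructure.subset_closure
    exact eq_top_iff.2 fun a _ => hS (hs ▸ Substructure.mem_top a)

end Maps

/-- The reduct of a structure embedding into one that encodes a homomorphism. -/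
theorem Encodes.exists_of_embedding {A B : Type w} [L.Structure B]
    [(overLanguage L T).Structure A] [(overLanguage L T).Structure B] {k : B →[L] T}
    (hB : Encodes k) (e : A ↪[overLanguage L T] B) :
    letI := decode L T A
    ∃ h : A →[L] T, Encodes h := by
  let := decode L T A
  let e' : A →[L] B :=
    { toFun := e
      map_fun' := fun {n} F x => by
        rw [← hB.funMap_eq F]
        exact e.map_fun (L := overLanguage L T) F x
      map_rel' := fun {n} R x hR => by
        rw [← hB.relMap_inl R]
        exact (e.map_rel (L := overLanguage L T) (Sum.inl R) x).2 hR }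
  refine ⟨k.comp e', ⟨fun _ _ => rfl, fun _ _ => Iff.rfl, fun {n} t x => ?_⟩⟩
  exact (e.map_rel (L := overLanguage L T) (Sum.inr t) x).symm.trans (hB.relMap_inr t _)

variable {K : Set (Bundled.{w} L.Structure)}

/-- The class of structures in the expanded language that encode a homomorphism from a member of
`K` to `T`. -/
def overClass (K : Set (Bundled.{w} L.Structure)) (T : Type w) [L.Structure T] :
    Set (Bundled.{w} (overLanguage L T).Structure) :=
  {N | ∃ (s : L.Structure N) (h : N →[L] T), Encodes h ∧ (⟨N, s⟩ : Bundled.{w} L.Structure) ∈ K}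

theorem Encodes.mem_overClass {A : Type w} [s : L.Structure A]
    [s' : (overLanguage L T).Structure A] {h : A →[L] T} (hA : Encodes h) :
    (⟨A, s'⟩ : Bundled.{w} (overLanguage L T).Structure) ∈ overClass K T ↔
      (⟨A, s⟩ : Bundled.{w} L.Structure) ∈ K := by
  refine ⟨?_, fun hK => ⟨s, h, hA, hK⟩⟩
  rintro ⟨r, k, hk, hK⟩
  have hrs : r = s :=
    (Encodes.decode_eq (s := r) (h := k) hk).symm.trans (Encodes.decode_eq (s := s) hA)
  subst hrs
  exact hK

/-- The ages correspond under the encoding. -/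
theorem Encodes.age_subset_iff {A : Type w} [L.Structure A] [(overLanguage L T).Structure A]
    {h : A →[L] T} (hA : Encodes h) :
    (overLanguage L T).age A ⊆ overClass K T ↔ L.age A ⊆ K := by
  constructor
  · rintro H N ⟨hN, ⟨e⟩⟩
    let := encode (h.comp e.toHom)
    have hE : Encodes (h.comp e.toHom) := encodes_encode _
    exact hE.mem_overClass.1 (H ⟨hE.fg_iff.2 hN, ⟨hE.liftEmbedding hA e fun _ => rfl⟩⟩)
  · rintro H N ⟨hN, ⟨e⟩⟩
    let := decode L T N
    obtain ⟨k, hk⟩ := hA.exists_of_embedding e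
    exact hk.mem_overClass.2 (H ⟨hk.fg_iff.1 hN, ⟨hk.lowerEmbedding hA e⟩⟩)

/-- A structure whose finitely generated substructures encode homomorphisms to `T` does so
itself. -/
theorem exists_encodes_of_age_subset {M : Type w} [(overLanguage L T).Structure M]
    (hM : (overLanguage L T).age M ⊆ overClass K T) :
    letI := decode L T M
    ∃ u : M →[L] T, Encodes u := by
  let := decode L T M
  have hloc : ∀ s : Set M, s.Finite → ∃ P : (overLanguage L T).Substructure M, s ⊆ P ∧
      ∃ (_ : L.Structure P) (h : P →[L] T), Encodes h := by
    intro s hs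
    let P := Substructure.closure (overLanguage L T) s
    obtain ⟨r, h, hh, -⟩ := hM (show (⟨P, inferInstance⟩ : Bundled.{w} (overLanguage L T).Structure) ∈ _ from
      ⟨(Substructure.fg_iff_structure_fg P).1 (Substructure.fg_closure hs), ⟨P.subtype⟩⟩)
    exact ⟨_, Substructure.subset_closure, r, h, hh⟩
  have hval : ∀ x : M, ∃ t : T,
      Structure.RelMap (L := overLanguage L T) (n := 1) (Sum.inr t) fun _ => x := by
    intro x
    obtain ⟨P, hP, r, h, hh⟩ := hloc {x} (Set.finite_singleton x)
    exact ⟨_, (hh.hom_eq_iff ⟨x, hP rfl⟩ _).1 rfl⟩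
  choose u hu using hval
  have hu_eq : ∀ (P : (overLanguage L T).Substructure M) (_ : L.Structure P) (h : P →[L] T),
      Encodes h → ∀ p : P, u p = h p :=
    fun P _ h hh p => ((hh.hom_eq_iff p (u p)).2 (hu p)).symm
  refine ⟨⟨u, fun {n} F x => ?_, fun {n} R x hR => ?_⟩,
    ⟨fun _ _ => rfl, fun _ _ => Iff.rfl, fun {n} t x => ?_⟩⟩ <;>
  obtain ⟨P, hP, r, h, hh⟩ := hloc (Set.range x) (Set.finite_range x) <;>
  let y : Fin n → P := fun i => ⟨x i, hP ⟨i, rfl⟩⟩ <;>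
  have hy : ∀ i, u (x i) = h (y i) := fun i => hu_eq P r h hh (y i)
  · have hF := hu_eq P r h hh (Structure.funMap (L := overLanguage L T) F y)
    rw [show u ∘ x = h ∘ y from funext hy, ← h.map_fun, ← hh.funMap_eq F y]
    exact hF
  · have hR' : Structure.RelMap R y := (hh.relMap_inl R y).1 hR
    have := h.map_rel R y hR'
    rwa [show (⇑h ∘ y) = u ∘ x from funext fun i => (hy i).symm] at this
  · exact (hh.relMap_inr t y).trans (forall_congr' fun i => by rw [← hy i]; rfl)

end UHomog

namespace UHomog

variable {L : FirstOrder.Language.{u, v}} {T : Type w} [L.Structure T]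
  {𝒰 K : Set (Bundled.{w} L.Structure)}

/-- There is at most one homomorphism from the substructure generated by the empty set. -/
theorem hom_closure_empty_ext {M N : Type w} [L.Structure M] [L.Structure N]
    (f g : (Substructure.closure L (∅ : Set M)) →[L] N) : f = g :=
  Hom.eq_of_eqOn_dense closure_empty_eq_top fun _ h => h.elim

/-- A homomorphism that is the first factor of an embedding is an embedding. -/
theorem exists_embedding_of_comp_eq {M N P : Type w} [L.Structure M] [L.Structure N]
    [L.Structure P] (f : M →[L] N) (g : N →[L] P) (e : M ↪[L] P) (h : g.comp f = e.toHom) :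
    ∃ f' : M ↪[L] N, f'.toHom = f := by
  have hx : ∀ x, g (f x) = e x := fun x => DFunLike.congr_fun h x
  refine ⟨⟨⟨f, fun x y hxy => e.injective ?_⟩, fun F x => f.map_fun F x, fun R x => ?_⟩, rfl⟩
  · rw [← hx, ← hx]
    exact congrArg g hxy
  · refine ⟨fun hR => (e.map_rel R x).1 ?_, fun hR => f.map_rel R x hR⟩
    have := g.map_rel R _ hR
    rwa [show e ∘ x = g ∘ f ∘ x from funext fun i => (hx (x i)).symm]

section

variable [Countable (Σ l, L.Functions l)]

theorem inBar_of_mem (hK : IsFraisse K) {N : Bundled.{w} L.Structure} (hN : N ∈ K) :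
    InBar L K N :=
  ⟨Structure.cg_iff_countable.1 (hK.FG N hN).cg, hK.hereditary N hN⟩

/-- Amalgamation over `T` in a class that is free in a class whose closure contains `T`. -/
theorem exists_amalgam_over (h𝒰 : IsFraisse 𝒰) (hT : InBar L 𝒰 T) (hK : IsFraisse K)
    (hfree : IsFreeIn L K 𝒰) {A B₁ B₂ : Bundled.{w} L.Structure} (hA : A ∈ K) (hB₁ : B₁ ∈ K)
    (hB₂ : B₂ ∈ K) (f₁ : A ↪[L] B₁) (f₂ : A ↪[L] B₂) (h₁ : B₁ →[L] T) (h₂ : B₂ →[L] T)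
    (hf : h₁.comp f₁.toHom = h₂.comp f₂.toHom) :
    ∃ (C : Bundled.{w} L.Structure) (g₁ : B₁ ↪[L] C) (g₂ : B₂ ↪[L] C) (h : C →[L] T),
      C ∈ K ∧ g₁.comp f₁ = g₂.comp f₂ ∧ h.comp g₁.toHom = h₁ ∧ h.comp g₂.toHom = h₂ := by
  obtain ⟨C, g₁, g₂, hC, hcomm, hpush⟩ := hfree.2 A B₁ B₂ hA hB₁ hB₂ f₁ f₂
  obtain ⟨D, k₁, k₂, hD, hk⟩ := hK.amalgamation A B₁ B₂ f₁ f₂ hA hB₁ hB₂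
  obtain ⟨m, ⟨hm₁, hm₂⟩, -⟩ := hpush D (inBar_of_mem h𝒰 (hfree.1 hD)) k₁.toHom k₂.toHom
    (congrArg Embedding.toHom hk)
  obtain ⟨g₁, rfl⟩ := exists_embedding_of_comp_eq g₁ m k₁ hm₁
  obtain ⟨g₂, rfl⟩ := exists_embedding_of_comp_eq g₂ m k₂ hm₂
  obtain ⟨h, ⟨hh₁, hh₂⟩, -⟩ := hpush ⟨T, inferInstance⟩ hT h₁ h₂ hf
  exact ⟨C, g₁, g₂, h, hC, Embedding.ext fun x => DFunLike.congr_fun hcomm x, hh₁, hh₂⟩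

/-- The structures over `T` with domain in `K` form a Fraïssé class. -/
theorem isFraisse_overClass (h𝒰 : IsFraisse 𝒰) (hT : InBar L 𝒰 T) (hK : IsFraisse K)
    (hfree : IsFreeIn L K 𝒰) : IsFraisse (overClass K T) := by
  have hTc : Countable T := hT.1
  have hamalg : ∀ (A B₁ B₂ : Bundled.{w} L.Structure) (_ : A ∈ K) (_ : B₁ ∈ K) (_ : B₂ ∈ K)
      (_ : (overLanguage L T).Structure B₁) (_ : (overLanguage L T).Structure B₂)
      (f₁ : A ↪[L] B₁) (f₂ : A ↪[L] B₂) (h₁ : B₁ →[L] T) (h₂ : B₂ →[L] T),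
      Encodes h₁ → Encodes h₂ → h₁.comp f₁.toHom = h₂.comp f₂.toHom →
      ∃ (C : Bundled.{w} (overLanguage L T).Structure) (g₁ : B₁ ↪[overLanguage L T] C)
        (g₂ : B₂ ↪[overLanguage L T] C), C ∈ overClass K T ∧ ∀ a, g₁ (f₁ a) = g₂ (f₂ a) := by
    intro A B₁ B₂ hA hB₁ hB₂ _ _ f₁ f₂ h₁ h₂ hh₁ hh₂ hf
    obtain ⟨C, g₁, g₂, h, hC, hg, hg₁, hg₂⟩ :=
      exists_amalgam_over h𝒰 hT hK hfree hA hB₁ hB₂ f₁ f₂ h₁ h₂ hf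
    let := encode h
    have hh : Encodes h := encodes_encode h
    exact ⟨⟨C, encode h⟩, hh₁.liftEmbedding hh g₁ (DFunLike.congr_fun hg₁),
      hh₂.liftEmbedding hh g₂ (DFunLike.congr_fun hg₂), hh.mem_overClass.2 hC,
      fun a => DFunLike.congr_fun hg a⟩
  refine ⟨?_, ?_, ?_, ?_, ?_, ?_⟩
  · obtain ⟨M, hM⟩ := hK.is_nonempty
    have hZ := hK.hereditary M hM (age.fg_substructure (S := Substructure.closure L (∅ : Set M))
      (Substructure.fg_closure Set.finite_empty))
    have hY := hT.2 (age.fg_substructure (S := Substructure.closure L (∅ : Set T))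
      (Substructure.fg_closure Set.finite_empty))
    obtain ⟨Q, -, ⟨f⟩, ⟨g⟩⟩ := h𝒰.jointEmbedding _ (hfree.1 hZ) _ hY
    obtain ⟨e⟩ := exists_embedding_closure_empty f g
    let h := ((Substructure.subtype _).comp e).toHom
    let := encode h
    exact ⟨⟨_, encode h⟩, (encodes_encode h).mem_overClass.2 hZ⟩
  · rintro N ⟨s, h, hh, hN⟩
    exact hh.fg_iff.2 (hK.FG _ hN)
  · obtain ⟨S, hS, hrep⟩ := exists_representatives hK
    have : ∀ n, Countable (S n →[L] T) := fun n => (hK.FG _ (hS n)).countable_hom T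
    refine (Set.countable_range fun p : Σ n, (S n →[L] T) =>
      (⟦⟨S p.1, encode p.2⟩⟧ : Quotient _)).mono ?_
    rintro _ ⟨N, ⟨s, h, hh, hN⟩, rfl⟩
    obtain ⟨n, ⟨e⟩⟩ := hrep _ hN
    refine ⟨⟨n, h.comp e.symm.toHom⟩, Quotient.sound ⟨?_⟩⟩
    let := encode (h.comp e.symm.toHom)
    exact (hh.liftEquiv (encodes_encode (h.comp e.symm.toHom)) e fun a =>
      congrArg h (Language.Equiv.symm_apply_apply e a)).symm
  · rintro N ⟨s, h, hh, hN⟩ P ⟨hP, ⟨e⟩⟩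
    let := decode L T P
    obtain ⟨k, hk⟩ := hh.exists_of_embedding e
    exact hk.mem_overClass.2 (hK.hereditary _ hN ⟨hk.fg_iff.1 hP, ⟨hk.lowerEmbedding hh e⟩⟩)
  · rintro N₁ ⟨s₁, h₁, hh₁, hN₁⟩ N₂ ⟨s₂, h₂, hh₂, hN₂⟩
    have hZ := hK.hereditary _ hN₁ (age.fg_substructure
      (S := Substructure.closure L (∅ : Set N₁)) (Substructure.fg_closure Set.finite_empty))
    obtain ⟨Q, -, ⟨f⟩, ⟨g⟩⟩ := hK.jointEmbedding _ hN₁ _ hN₂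
    obtain ⟨e⟩ := exists_embedding_closure_empty (f.comp (Substructure.subtype _)) g
    obtain ⟨C, g₁, g₂, hC, -⟩ := hamalg _ _ _ hZ hN₁ hN₂ _ _ (Substructure.subtype _) e h₁ h₂
      hh₁ hh₂ (hom_closure_empty_ext _ _)
    exact ⟨C, hC, ⟨g₁⟩, ⟨g₂⟩⟩
  · rintro A N₁ N₂ f₁ f₂ ⟨s, h, hh, hA⟩ ⟨s₁, h₁, hh₁, hN₁⟩ ⟨s₂, h₂, hh₂, hN₂⟩
    obtain ⟨C, g₁, g₂, hC, hg⟩ := hamalg _ _ _ hA hN₁ hN₂ _ _ (hh.lowerEmbedding hh₁ f₁)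
      (hh.lowerEmbedding hh₂ f₂) h₁ h₂ hh₁ hh₂ (Hom.ext fun a =>
        (hh.hom_apply_embedding hh₁ f₁ a).trans (hh.hom_apply_embedding hh₂ f₂ a).symm)
    exact ⟨C, g₁, g₂, hC, Embedding.ext hg⟩

end

/-! ### Homogeneity -/

/-- Homogeneity for embeddings of an abstract finitely generated structure. -/
theorem IsHomogeneousHom.exists_equiv {U : Type w} [L.Structure U] {u : U →[L] T}
    (hu : IsHomogeneousHom L u) {A : Type w} [L.Structure A] (hA : Structure.FG L A)
    (e₁ e₂ : A ↪[L] U) (he : ∀ a, u (e₁ a) = u (e₂ a)) :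
    ∃ α : U ≃[L] U, (∀ x, u (α x) = u x) ∧ ∀ a, α (e₁ a) = e₂ a := by
  obtain ⟨α, hα, hαe⟩ := hu e₁.toHom.range (hA.range e₁.toHom)
    (e₂.comp e₁.equivRange.symm.toEmbedding) fun s => by
      obtain ⟨a, rfl⟩ := e₁.equivRange.surjective s
      simpa using (he a).symm
  refine ⟨α, hα, fun a => ?_⟩
  simpa using hαe (e₁.equivRange a)

/-- Ultrahomogeneity for embeddings of an abstract finitely generated structure. -/
theorem IsUltrahomogeneous.exists_equiv {M : Type w} [L.Structure M]
    (hM : L.IsUltrahomogeneous M) {A : Type w} [L.Structure A] (hA : Structure.FG L A)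
    (e₁ e₂ : A ↪[L] M) : ∃ α : M ≃[L] M, ∀ a, α (e₁ a) = e₂ a := by
  obtain ⟨α, hα⟩ := hM e₁.toHom.range (hA.range e₁.toHom)
    (e₂.comp e₁.equivRange.symm.toEmbedding)
  refine ⟨α, fun a => ?_⟩
  simpa using (DFunLike.congr_fun hα (e₁.equivRange a)).symm

section Encoded

variable {U : Type w} [L.Structure U] [(overLanguage L T).Structure U] {u : U →[L] T}

/-- A homomorphism encoded by an ultrahomogeneous structure is homogeneous. -/
theorem Encodes.isHomogeneousHom (hU : Encodes u)
    (hhom : (overLanguage L T).IsUltrahomogeneous U) : IsHomogeneousHom L u := by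
  intro S hS ι hι
  let k := u.comp S.subtype.toHom
  let := encode k
  have hk : Encodes k := encodes_encode k
  obtain ⟨α, hα⟩ := IsUltrahomogeneous.exists_equiv hhom
    (hk.fg_iff.2 ((Substructure.fg_iff_structure_fg S).1 hS))
    (hk.liftEmbedding hU S.subtype fun _ => rfl) (hk.liftEmbedding hU ι hι)
  exact ⟨hU.lowerEquiv hU α, hU.hom_apply_embedding hU α.toEmbedding, hα⟩

/-- A structure encoding a homogeneous homomorphism is ultrahomogeneous. -/
theorem Encodes.isUltrahomogeneous (hU : Encodes u) (hu : IsHomogeneousHom L u) :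
    (overLanguage L T).IsUltrahomogeneous U := by
  intro S hS ι
  let := decode L T S
  obtain ⟨k, hk⟩ := hU.exists_of_embedding S.subtype
  obtain ⟨α, hα, hαι⟩ := hu.exists_equiv
    (hk.fg_iff.1 ((Substructure.fg_iff_structure_fg S).1 hS))
    (hk.lowerEmbedding hU S.subtype) (hk.lowerEmbedding hU ι) fun a =>
      (hk.hom_apply_embedding hU S.subtype a).trans (hk.hom_apply_embedding hU ι a).symm
  exact ⟨hU.liftEquiv hU α hα, Embedding.ext fun a => (hαι a).symm⟩

end Encoded

/-- A structure encoding a universal homogeneous homomorphism is a Fraïssé limit. -/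
theorem Encodes.isFraisseLimit [Countable (Σ l, L.Functions l)] (hK : IsFraisse K)
    {U : Type w} [Countable U] [L.Structure U] [(overLanguage L T).Structure U] {u : U →[L] T}
    (hU : Encodes u) (hage : L.age U ⊆ K) (huniv : IsUniversalHom L K u) (hhom : IsHomogeneousHom L u) :
    IsFraisseLimit (overClass K T) U := by
  refine ⟨hU.isUltrahomogeneous hhom, (hU.age_subset_iff.2 hage).antisymm ?_⟩
  rintro N ⟨s, h, hh, hN⟩
  obtain ⟨ι, hι⟩ := huniv _ (inBar_of_mem hK hN) h
  exact ⟨hh.fg_iff.2 (hK.FG _ hN), ⟨hh.liftEmbedding hU ι hι⟩⟩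

end UHomog


open UHomog FirstOrder FirstOrder.Language in
/-- Theorem: if `𝒰` is a strict Fraïssé class, `T ∈ 𝒰̄` and `K ⊆ 𝒰` is a Fraïssé class that is
free in `𝒰`, then there is a universal homogeneous homomorphism `u : U → T` within `K̄`, and it
is unique up to isomorphism of its domain. -/
theorem statement4
    (L : FirstOrder.Language.{u, v})
    [Countable (Σ l, L.Functions l)] [Countable (Σ l, L.Relations l)]
    (𝒰 K : Set (Bundled.{w} L.Structure))
    (h𝒰 : IsStrictFraisse L 𝒰)
    (T : Type w) [L.Structure T] (hT : InBar L 𝒰 T)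
    (hK : IsFraisse K) (hfree : IsFreeIn L K 𝒰) :
    ∃ (U : Bundled.{w} L.Structure) (u : U →[L] T),
      InBar L K U ∧ IsUniversalHom L K u ∧ IsHomogeneousHom L u ∧
      ∀ (U' : Bundled.{w} L.Structure) (u' : U' →[L] T),
        InBar L K U' → IsUniversalHom L K u' → IsHomogeneousHom L u' →
        ∃ h : U' ≃[L] U, ∀ x : U', u (h x) = u' x := by
  obtain ⟨M, hMc, hM, habs⟩ := exists_isFraisseLimit (isFraisse_overClass h𝒰.1 hT hK hfree)
  let := decode L T M
  obtain ⟨u, hu⟩ := exists_encodes_of_age_subset hM.age.subset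
  refine ⟨⟨M, decode L T M⟩, u, ⟨hMc, hu.age_subset_iff.1 hM.age.subset⟩, ?_,
    hu.isHomogeneousHom hM.ultrahomogeneous, ?_⟩
  · intro A hA h
    let := encode h
    have hh : Encodes h := encodes_encode h
    obtain ⟨e⟩ := habs ⟨A, encode h⟩ hA.1 (hh.age_subset_iff.2 hA.2)
    exact ⟨hh.lowerEmbedding hu e, hh.hom_apply_embedding hu e⟩
  · intro U' u' hbar huniv hhom
    let := encode u'
    have hu' : Encodes u' := encodes_encode u'
    have : Countable U' := hbar.1
    obtain ⟨e⟩ := (hu'.isFraisseLimit hK hbar.2 huniv hhom).nonempty_equiv hM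
    exact ⟨hu'.lowerEquiv hu e, hu'.hom_apply_embedding hu e.toEmbedding⟩
end

section
/- Let 𝒞 be a strict Fraïssé class with Fraïssé limit U, such that (1) 𝒞 is closed with respect to finite products, (2) 𝒞 has the homo amalgamation property (HAP), (3) the coproduct of countably many copies of U exists in the category of countable structures with age contained in 𝒞 and homomorphisms as morphisms, and (4) End U is not finitely generated as a monoid. Then the clone Pol U has the Bergman property. -/
universe u v w

open FirstOrder FirstOrder.Language CategoryTheory

namespace CloneTheory

/-- Finitary operations on `A`: the element `⟨n, f⟩` is an operation of arity `n + 1`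
(so all arities are `≥ 1`). -/
def Ops (A : Type w) : Type w := Σ n : ℕ, (Fin (n + 1) → A) → A

/-- `S` is a clone on `A`: it contains all projections and is closed under composition. -/
structure IsClone (A : Type w) (S : Set (Ops A)) : Prop where
  proj : ∀ (n : ℕ) (i : Fin (n + 1)), (⟨n, fun x => x i⟩ : Ops A) ∈ S
  comp : ∀ (n m : ℕ) (f : (Fin (n + 1) → A) → A) (g : Fin (n + 1) → (Fin (m + 1) → A) → A),
    (⟨n, f⟩ : Ops A) ∈ S → (∀ i, (⟨m, g i⟩ : Ops A) ∈ S) →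
    (⟨m, fun x => f fun i => g i x⟩ : Ops A) ∈ S

/-- The clone generated by a set of operations. -/
def cloneGen (A : Type w) (M : Set (Ops A)) : Set (Ops A) :=
  ⋂₀ {S : Set (Ops A) | IsClone A S ∧ M ⊆ S}

/-- The complex product of two sets of operations. -/
def cProd (A : Type w) (U V : Set (Ops A)) : Set (Ops A) :=
  {op | ∃ (n m : ℕ) (f : (Fin (n + 1) → A) → A) (g : Fin (n + 1) → (Fin (m + 1) → A) → A),
    (⟨n, f⟩ : Ops A) ∈ U ∧ (∀ i, (⟨m, g i⟩ : Ops A) ∈ V) ∧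
    op = ⟨m, fun x => f fun i => g i x⟩}

/-- The set `J_A^{(k)}` of projections of arity `k + 1`. -/
def projSet (A : Type w) (k : ℕ) : Set (Ops A) :=
  {op | ∃ i : Fin (k + 1), op = ⟨k, fun x => x i⟩}

/-- The sets `U^{[k,i]}`: operations of arity `k + 1` obtained from `U` by terms of depth
at most `i`. -/
def iter (A : Type w) (U : Set (Ops A)) (k : ℕ) : ℕ → Set (Ops A)
  | 0 => projSet A k
  | i + 1 => cProd A U (iter A U k i) ∪ iter A U k i

/-- The part of `F` of arity `k + 1`. -/
def arityPart (A : Type w) (F : Set (Ops A)) (k : ℕ) : Set (Ops A) :=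
  {op | op ∈ F ∧ op.1 = k}

/-- A clone `F` has the Bergman property if for every generating set `H` and every arity there
is a uniform depth bound generating the whole part of that arity. -/
def BergmanProperty (A : Type w) (F : Set (Ops A)) : Prop :=
  ∀ H : Set (Ops A), H ⊆ F → cloneGen A H = F →
    ∀ k : ℕ, ∃ n : ℕ, iter A H k n = arityPart A F k

/-- A clone `F` has uncountable cofinality: there is no countable increasing chain of proper
subclones of `F` whose union is `F`. -/
def UncountableCofinality (A : Type w) (F : Set (Ops A)) : Prop :=
  ¬ ∃ c : ℕ → Set (Ops A),
      (∀ n, IsClone A (c n)) ∧ (∀ n, c n ⊆ F) ∧ (∀ n, c n ⊆ c (n + 1)) ∧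
      (∀ n, c n ≠ F) ∧ (⋃ n, c n) = F

/-- A clone `F` has uncountable strong cofinality: there is no countable strong cofinal chain
for `F`. -/
def UncountableStrongCofinality (A : Type w) (F : Set (Ops A)) : Prop :=
  ¬ ∃ c : ℕ → Set (Ops A),
      (∀ n, c n ⊆ c (n + 1)) ∧ (∀ n, c n ⊆ F) ∧ (∀ n, c n ≠ F) ∧ (⋃ n, c n) = F ∧
      (∃ k₀ : ℕ, ∀ n, ∀ k, k₀ ≤ k → arityPart A (c n) k ≠ arityPart A F k) ∧
      (∀ n, ∃ m, ∀ k, iter A (c n) k 2 ⊆ c m)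

/-- A clone is finitely generated if it is generated by a finite set. -/
def FinitelyGeneratedClone (A : Type w) (F : Set (Ops A)) : Prop :=
  ∃ H : Set (Ops A), H.Finite ∧ H ⊆ F ∧ cloneGen A H = F

end CloneTheory

namespace CloneTheory

open FirstOrder FirstOrder.Language

/-- The product (power) structure on `ι → M`. -/
instance piStructure (L : FirstOrder.Language.{u, v}) (ι : Type*) (M : Type w)
    [L.Structure M] : L.Structure (ι → M) where
  funMap f x i := Structure.funMap f fun j => x j i
  RelMap r x := ∀ i, Structure.RelMap r fun j => x j i

/-- The product structure on `M × N`. -/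
instance prodStructure (L : FirstOrder.Language.{u, v}) (M N : Type w)
    [L.Structure M] [L.Structure N] : L.Structure (M × N) where
  funMap f x := (Structure.funMap f fun i => (x i).1, Structure.funMap f fun i => (x i).2)
  RelMap r x := Structure.RelMap r (fun i => (x i).1) ∧ Structure.RelMap r fun i => (x i).2

/-- The polymorphism clone of a structure `M`. -/
def PolSet (L : FirstOrder.Language.{u, v}) (M : Type w) [L.Structure M] : Set (Ops M) :=
  {op | ∃ h : (Fin (op.1 + 1) → M) →[L] M, ⇑h = op.2}

end CloneTheory

namespace UHomog

open FirstOrder FirstOrder.Language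

/-- The coproduct of countably many copies of `U` exists in the category of countable structures
with age contained in `K`, with homomorphisms as morphisms. -/
def CoproductOfCopiesExists (L : FirstOrder.Language.{u, v})
    (K : Set (Bundled.{w} L.Structure)) (U : Type w) [L.Structure U] : Prop :=
  ∃ (C : Bundled.{w} L.Structure) (ins : ℕ → (U →[L] C)),
    InBar L K C ∧
    ∀ D : Bundled.{w} L.Structure, InBar L K D → ∀ f : ℕ → (U →[L] D),
      ∃! g : C →[L] D, ∀ i, g.comp (ins i) = f i

/-- The submonoid of the endomorphism monoid generated by a set of endomorphisms. -/
def monClosure (L : FirstOrder.Language.{u, v}) (U : Type w) [L.Structure U]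
    (S : Set (U →[L] U)) : Set (U →[L] U) :=
  ⋂₀ {T | S ⊆ T ∧ Hom.id L U ∈ T ∧ ∀ f ∈ T, ∀ g ∈ T, f.comp g ∈ T}

/-- The endomorphism monoid of `U` is finitely generated. -/
def EndFinitelyGenerated (L : FirstOrder.Language.{u, v}) (U : Type w) [L.Structure U] : Prop :=
  ∃ S : Set (U →[L] U), S.Finite ∧ monClosure L U S = Set.univ

end UHomog

namespace FirstOrder.Language

variable {L : FirstOrder.Language.{u, v}}

/-- Compatible homomorphisms on an increasing chain of substructures covering `M` glue to a
homomorphism on `M`. -/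
theorem exists_hom_of_chain {M N : Type*} [L.Structure M] [L.Structure N]
    (P : ℕ → L.Substructure M) (hP : Monotone P) (hcover : ∀ x, ∃ n, x ∈ P n)
    (φ : ∀ n, P n →[L] N)
    (hφ : ∀ n (x : P n), φ (n + 1) ⟨x, hP n.le_succ x.2⟩ = φ n x) :
    ∃ Φ : M →[L] N, ∀ n (x : P n), Φ x = φ n x := by
  have hle : ∀ n m (hnm : n ≤ m) (x : P n), φ m ⟨x, hP hnm x.2⟩ = φ n x := by
    intro n m hnm
    induction m, hnm using Nat.le_induction with
    | base => intro x; rfl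
    | succ m hnm ih => intro x; rw [← ih x]; exact hφ m ⟨x, hP hnm x.2⟩
  choose d hd using hcover
  have hΦ : ∀ n (x : P n), φ (d x) ⟨x, hd x⟩ = φ n x := by
    intro n x
    rw [← hle _ (max (d x) n) (le_max_left _ _), ← hle n (max (d x) n) (le_max_right _ _)]
  have hbound : ∀ {l : ℕ} (x : Fin l → M), ∃ n, ∀ i, x i ∈ P n := by
    intro l x
    exact ⟨Finset.univ.sup fun i => d (x i), fun i =>
      hP (Finset.le_sup (f := fun i => d (x i)) (Finset.mem_univ i)) (hd (x i))⟩
  refine ⟨⟨fun x => φ (d x) ⟨x, hd x⟩, ?_, ?_⟩, hΦ⟩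
  · intro l f x
    obtain ⟨n, hn⟩ := hbound x
    have hfun : Function.comp (fun x => φ (d x) ⟨x, hd x⟩) x =
        φ n ∘ fun i => (⟨x i, hn i⟩ : P n) := funext fun i => hΦ n ⟨x i, hn i⟩
    rw [hfun, ← (φ n).map_fun]
    exact hΦ n (Structure.funMap f fun i => (⟨x i, hn i⟩ : P n))
  · intro l r x hr
    obtain ⟨n, hn⟩ := hbound x
    have hfun : Function.comp (fun x => φ (d x) ⟨x, hd x⟩) x =
        φ n ∘ fun i => (⟨x i, hn i⟩ : P n) := funext fun i => hΦ n ⟨x i, hn i⟩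
    rw [hfun]
    exact (φ n).map_rel r (fun i => (⟨x i, hn i⟩ : P n)) hr

/-- A countable structure is the union of a chain of finitely generated substructures. -/
theorem exists_fg_chain (L : FirstOrder.Language.{u, v}) (M : Type*) [L.Structure M]
    [Countable M] :
    ∃ S : ℕ → L.Substructure M, Monotone S ∧ (∀ n, (S n).FG) ∧ ∀ x, ∃ n, x ∈ S n := by
  obtain ⟨c, hc⟩ := exists_injective_nat M
  refine ⟨fun n => Substructure.closure L {x | c x < n}, ?_, ?_, ?_⟩
  · exact fun m n hmn => Substructure.closure_mono fun x hx => lt_of_lt_of_le hx hmn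
  · exact fun n => Substructure.fg_closure ((Set.finite_lt_nat n).preimage hc.injOn)
  · exact fun x => ⟨c x + 1, Substructure.subset_closure (Nat.lt_succ_self (c x))⟩

/-- If a composite of homomorphisms is an embedding, then so is the first factor. -/
theorem Hom.exists_embedding_of_comp {A B C : Type*} [L.Structure A] [L.Structure B]
    [L.Structure C] (g : A →[L] B) (m : B →[L] C) (e : A ↪[L] C)
    (h : m.comp g = e.toHom) : ∃ g' : A ↪[L] B, g'.toHom = g := by
  have hx : ∀ a, m (g a) = e a := fun a => DFunLike.congr_fun h a
  refine ⟨⟨⟨g, ?_⟩, fun f x => g.map_fun f x, ?_⟩, Hom.ext fun _ => rfl⟩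
  · intro a b hab
    exact e.injective (by rw [← hx, ← hx, hab])
  · intro n r x
    refine ⟨fun hr => (e.map_rel r x).1 ?_, fun hr => g.map_rel r x hr⟩
    have := m.map_rel r _ hr
    rwa [show m ∘ (g ∘ x) = e ∘ x from funext fun i => hx (x i)] at this

end FirstOrder.Language

namespace UHomog

variable {L : FirstOrder.Language.{u, v}} {K : Set (Bundled.{w} L.Structure)}

theorem InBar.fg_mem {A : Type w} [L.Structure A] (hA : InBar L K A) {S : L.Substructure A}
    (hS : S.FG) : (Bundled.of S : Bundled.{w} L.Structure) ∈ K :=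
  hA.2 (age.fg_substructure hS)

section FraisseLimit

variable [Countable (Σ l, L.Functions l)] {U : Type w} [L.Structure U] [Countable U]

theorem _root_.FirstOrder.Language.IsFraisseLimit.inBar (hU : IsFraisseLimit K U) :
    InBar L K U :=
  ⟨inferInstance, hU.age.le⟩

/-- A member of `K` extending a finitely generated substructure of the Fraïssé limit can be
embedded into the limit over that substructure. -/
theorem exists_embedding_over (hU : IsFraisseLimit K U) {S : Type*} [L.Structure S]
    (hS : Structure.FG L S) (i : S ↪[L] U) {D : Bundled.{w} L.Structure} (hD : D ∈ K)
    (j : S ↪[L] D) : ∃ q : D ↪[L] U, ∀ s, q (j s) = i s := by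
  rw [← hU.age] at hD
  have := hD.2
  obtain ⟨q, hq⟩ := hU.ultrahomogeneous.extend_embedding hS i j
  exact ⟨q, fun s => by rw [hq]; rfl⟩

/-- Under the HAP, homomorphisms between finitely generated parts of the Fraïssé limit extend
to larger finitely generated domains. -/
theorem exists_hom_extension (hU : IsFraisseLimit K U) (hhap : HAP L K)
    {A B : Bundled.{w} L.Structure} (hA : A ∈ K) (hB : B ∈ K) (j : A ↪[L] B) (φ : A →[L] U) :
    ∃ ψ : B →[L] U, ∀ a, ψ (j a) = φ a := by
  have hAfg : Structure.FG L A := by rw [← hU.age] at hA; exact hA.1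
  have hR : φ.range.FG := hAfg.range φ
  obtain ⟨C, g₁, g₂, hC, hg⟩ := hhap A B (Bundled.of φ.range) hA hB (hU.inBar.fg_mem hR) j
    (φ.codRestrict φ.range φ.mem_range_self)
  obtain ⟨q, hq⟩ := exists_embedding_over hU ((Substructure.fg_iff_structure_fg _).1 hR)
    φ.range.subtype hC g₂
  refine ⟨q.toHom.comp g₁, fun a => ?_⟩
  have h := DFunLike.congr_fun hg a
  simp only [Hom.comp_apply, Embedding.coe_toHom] at h ⊢
  rw [h]
  exact hq _

/-- One step of the construction of a universal homomorphism into the Fraïssé limit: a pushout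
amalgam of `P` with an extension of `S` over `S` is realised inside the limit
over `P`, and enlarged by `W`. -/
theorem exists_pushout_step (hK : IsStrictFraisse L K) (hU : IsFraisseLimit K U)
    (hhap : HAP L K) {A : Type w} [L.Structure A] (hA : InBar L K A)
    {S S' : L.Substructure A} (hS : S.FG) (hS' : S'.FG) (hSS' : S ≤ S')
    {P W : L.Substructure U} (hP : P.FG) (hW : W.FG) (e : S ↪[L] P) :
    ∃ (P' : L.Substructure U) (hPP' : P ≤ P') (e' : S' ↪[L] P'), P'.FG ∧ W ≤ P' ∧
      (∀ s : S, (e' (Substructure.inclusion hSS' s) : U) = e s) ∧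
      ∀ (φ : P →[L] U) (G : S' →[L] U),
        (∀ s, φ (e s) = G (Substructure.inclusion hSS' s)) →
        ∃ ψ : P' →[L] U, (∀ x, ψ (Substructure.inclusion hPP' x) = φ x) ∧
          ∀ s, ψ (e' s) = G s := by
  have hSK := hA.fg_mem hS
  have hSK' := hA.fg_mem hS'
  have hPK := hU.inBar.fg_mem hP
  obtain ⟨Q, g₁, g₂, hQ, hcomm, huniv⟩ := hK.2 (Bundled.of S) (Bundled.of P) (Bundled.of S')
    hSK hPK hSK' e (Substructure.inclusion hSS')
  obtain ⟨D, d₁, d₂, hD, hd⟩ := hK.1.amalgamation (Bundled.of S) (Bundled.of P) (Bundled.of S')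
    e (Substructure.inclusion hSS') hSK hPK hSK'
  have hDbar : InBar L K D := by
    refine ⟨?_, hK.1.hereditary D hD⟩
    rw [← hU.age] at hD
    obtain ⟨i⟩ := hD.2
    exact i.injective.countable
  obtain ⟨m, ⟨hm₁, hm₂⟩, -⟩ := huniv D hDbar d₁.toHom d₂.toHom
    (Hom.ext fun s => DFunLike.congr_fun hd s)
  obtain ⟨g₁, rfl⟩ := Hom.exists_embedding_of_comp g₁ m d₁ hm₁
  obtain ⟨g₂, rfl⟩ := Hom.exists_embedding_of_comp g₂ m d₂ hm₂
  obtain ⟨q, hq⟩ := exists_embedding_over hU ((Substructure.fg_iff_structure_fg _).1 hP)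
    P.subtype hQ g₁
  have hQR : q.toHom.range.FG := (hK.1.FG Q hQ).range q.toHom
  have hP' : (q.toHom.range ⊔ W).FG := hQR.sup hW
  have hqmem : ∀ x, q x ∈ q.toHom.range ⊔ W := fun x =>
    (le_sup_left : q.toHom.range ≤ q.toHom.range ⊔ W) (q.toHom.mem_range_self x)
  have hPP' : P ≤ q.toHom.range ⊔ W := by
    intro x hx
    rw [show x = q (g₁ ⟨x, hx⟩) from (hq ⟨x, hx⟩).symm]
    exact hqmem _
  refine ⟨q.toHom.range ⊔ W, hPP', (q.comp g₂).codRestrict _ fun s => hqmem _, hP', le_sup_right,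
    ?_, ?_⟩
  · intro s
    have h := DFunLike.congr_fun hcomm s
    change g₁ (e s) = g₂ (Substructure.inclusion hSS' s) at h
    exact (congrArg q h.symm).trans (hq (e s))
  · intro φ G hφ
    obtain ⟨n, ⟨hn₁, hn₂⟩, -⟩ := huniv (Bundled.of U) hU.inBar φ G (Hom.ext hφ)
    obtain ⟨ψ, hψ⟩ := exists_hom_extension hU hhap hQ (hU.inBar.fg_mem hP')
      (q.codRestrict _ hqmem) n
    refine ⟨ψ, fun x => ?_, fun s => ?_⟩
    · refine Eq.trans (congrArg ψ (Subtype.ext ?_))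
        ((hψ (g₁ x)).trans (DFunLike.congr_fun hn₁ x))
      exact (hq x).symm
    · exact (hψ (g₂ s)).trans (DFunLike.congr_fun hn₂ s)

/-- Every countable structure with age in `K` has a homomorphism into the Fraïssé limit along
which all its homomorphisms into the limit extend to endomorphisms. -/
theorem exists_hom_forall_factor (hK : IsStrictFraisse L K) (hU : IsFraisseLimit K U)
    (hhap : HAP L K) {A : Type w} [L.Structure A] (hA : InBar L K A) :
    ∃ e : A →[L] U, ∀ F : A →[L] U, ∃ g : U →[L] U, g.comp e = F := by
  have := hA.1
  obtain ⟨S, hSmono, hSfg, hScover⟩ := exists_fg_chain L A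
  obtain ⟨W, -, hWfg, hWcover⟩ := exists_fg_chain L U
  have step : ∀ n (p : Σ P : {P : L.Substructure U // P.FG}, S n ↪[L] P.1),
      ∃ (p' : Σ P : {P : L.Substructure U // P.FG}, S (n + 1) ↪[L] P.1)
        (hle : p.1.1 ≤ p'.1.1), W n ≤ p'.1.1 ∧
        (∀ s : S n, (p'.2 (Substructure.inclusion (hSmono n.le_succ) s) : U) = p.2 s) ∧
        ∀ (φ : p.1.1 →[L] U) (G : S (n + 1) →[L] U),
          (∀ s, φ (p.2 s) = G (Substructure.inclusion (hSmono n.le_succ) s)) →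
          ∃ ψ : p'.1.1 →[L] U, (∀ x, ψ (Substructure.inclusion hle x) = φ x) ∧
            ∀ s, ψ (p'.2 s) = G s := by
    rintro n ⟨⟨P, hP⟩, e⟩
    obtain ⟨P', hPP', e', hP', hW, he', hext⟩ := exists_pushout_step hK hU hhap hA (hSfg n)
      (hSfg (n + 1)) (hSmono n.le_succ) hP (hWfg n) e
    exact ⟨⟨⟨P', hP'⟩, e'⟩, hPP', hW, he', hext⟩
  choose next hle hW he hext using step
  have h₀ : (Bundled.of (S 0) : Bundled.{w} L.Structure) ∈ L.age U := by
    rw [hU.age]; exact hA.fg_mem (hSfg 0)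
  obtain ⟨i₀⟩ := h₀.2
  let p : ∀ n, Σ P : {P : L.Substructure U // P.FG}, S n ↪[L] P.1 := fun n =>
    Nat.rec ⟨⟨i₀.toHom.range, h₀.1.range i₀.toHom⟩, i₀.equivRange.toEmbedding⟩ next n
  have hPmono : Monotone fun n => (p n).1.1 := monotone_nat_of_le_succ fun n => hle n (p n)
  obtain ⟨e, hee⟩ := exists_hom_of_chain S hSmono hScover
    (fun n => (p n).1.1.subtype.toHom.comp (p n).2.toHom) fun n s => he n (p n) s
  refine ⟨e, fun F => ?_⟩
  let Φ : ∀ n, {φ : (p n).1.1 →[L] U // ∀ s, φ ((p n).2 s) = F s} := fun n =>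
    Nat.rec
      ⟨(F.domRestrict (S 0)).comp i₀.equivRange.symm.toHom, fun s =>
        congrArg (fun t : S 0 => F t) (i₀.equivRange.symm_apply_apply s)⟩
      (fun n φ => ⟨(hext n (p n) φ.1 (F.domRestrict (S (n + 1))) φ.2).choose,
        (hext n (p n) φ.1 (F.domRestrict (S (n + 1))) φ.2).choose_spec.2⟩) n
  obtain ⟨g, hg⟩ := exists_hom_of_chain (fun n => (p n).1.1) hPmono
    (fun x => (hWcover x).imp' (· + 1) fun n hx => hW n (p n) hx)
    (fun n => (Φ n).1)
    (fun n x => (hext n (p n) (Φ n).1 (F.domRestrict (S (n + 1))) (Φ n).2).choose_spec.1 x)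
  refine ⟨g, Hom.ext fun a => ?_⟩
  obtain ⟨n, hn⟩ := hScover a
  rw [Hom.comp_apply, show e a = (p n).2 ⟨a, hn⟩ from hee n ⟨a, hn⟩, hg n]
  exact (Φ n).2 ⟨a, hn⟩

/-- Every sequence of endomorphisms is obtained from three endomorphisms by words of linear
length. -/
theorem exists_hom_sequence_words (hK : IsStrictFraisse L K) (hU : IsFraisseLimit K U)
    (hhap : HAP L K) (hcoprod : CoproductOfCopiesExists L K U) (f : ℕ → (U →[L] U)) :
    ∃ a b c : U →[L] U, ∀ n x, c (b^[n] (a x)) = f n x := by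
  obtain ⟨C, ins, hC, huniv⟩ := hcoprod
  obtain ⟨e, he⟩ := exists_hom_forall_factor hK hU hhap hC
  obtain ⟨σ, hσ, -⟩ := huniv C hC fun i => ins (i + 1)
  obtain ⟨F, hF, -⟩ := huniv (Bundled.of U) hU.inBar f
  obtain ⟨b, hb⟩ := he (e.comp σ)
  obtain ⟨c, hc⟩ := he F
  refine ⟨e.comp (ins 0), b, c, fun n x => ?_⟩
  have hpow : ∀ n, b^[n] (e (ins 0 x)) = e (ins n x) := by
    intro n
    induction n with
    | zero => rfl
    | succ n ih =>
      rw [Function.iterate_succ_apply', ih, ← hσ n]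
      exact DFunLike.congr_fun hb (ins n x)
  rw [Hom.comp_apply, hpow, ← hF n]
  exact DFunLike.congr_fun hc (ins n x)

end FraisseLimit

theorem InBar.of_embedding {A B : Type w} [L.Structure A] [L.Structure B] (hB : InBar L K B)
    (i : A ↪[L] B) : InBar L K A :=
  ⟨haveI := hB.1; i.injective.countable, fun _ hN => hB.2 ⟨hN.1, hN.2.map i.comp⟩⟩

theorem InBar.prod (hher : Hereditary K)
    (hprod : ∀ A B : Bundled.{w} L.Structure, A ∈ K → B ∈ K →
      (Bundled.of (↥A × ↥B) : Bundled.{w} L.Structure) ∈ K)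
    {A B : Type w} [L.Structure A] [L.Structure B] (hA : InBar L K A) (hB : InBar L K B) :
    InBar L K (A × B) := by
  have := hA.1
  have := hB.1
  refine ⟨inferInstance, ?_⟩
  rintro N ⟨hN, ⟨i⟩⟩
  let p : (A × B) →[L] A := ⟨Prod.fst, fun _ _ => rfl, fun _ _ h => h.1⟩
  let q : (A × B) →[L] B := ⟨Prod.snd, fun _ _ => rfl, fun _ _ h => h.2⟩
  let p' := p.comp i.toHom
  let q' := q.comp i.toHom
  refine hher _ (hprod (Bundled.of p'.range) (Bundled.of q'.range)
    (hA.fg_mem (hN.range p')) (hB.fg_mem (hN.range q'))) ⟨hN, ⟨?_⟩⟩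
  refine ⟨⟨fun x => (⟨p' x, p'.mem_range_self x⟩, ⟨q' x, q'.mem_range_self x⟩), ?_⟩, ?_, ?_⟩
  · intro x y hxy
    refine i.injective (Prod.ext ?_ ?_)
    · exact congrArg Subtype.val (congrArg Prod.fst hxy)
    · exact congrArg Subtype.val (congrArg Prod.snd hxy)
  · intro n f x
    exact Prod.ext (Subtype.ext (p'.map_fun f x)) (Subtype.ext (q'.map_fun f x))
  · intro n r x
    exact i.map_rel r x

theorem InBar.pow (hher : Hereditary K)
    (hprod : ∀ A B : Bundled.{w} L.Structure, A ∈ K → B ∈ K →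
      (Bundled.of (↥A × ↥B) : Bundled.{w} L.Structure) ∈ K)
    {A : Type w} [L.Structure A] (hA : InBar L K A) (k : ℕ) :
    InBar L K (Fin (k + 1) → A) := by
  induction k with
  | zero =>
    refine hA.of_embedding ⟨⟨fun x => x 0, ?_⟩, fun f x => rfl, fun r x => ?_⟩
    · exact fun x y hxy => funext fun i => by rw [Fin.fin_one_eq_zero i]; exact hxy
    · exact ⟨fun h i => by rw [Fin.fin_one_eq_zero i]; exact h, fun h => h 0⟩
  | succ k ih =>
    refine (hA.prod hher hprod ih).of_embedding
      ⟨⟨fun x => (x 0, fun i => x i.succ), ?_⟩, fun f x => rfl, fun r x => ?_⟩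
    · intro x y hxy
      exact funext (Fin.cases (congrArg Prod.fst hxy) (congrFun (congrArg Prod.snd hxy)))
    · exact ⟨fun h => Fin.cases h.1 h.2, fun h => ⟨h 0, fun i => h i.succ⟩⟩

end UHomog

namespace CloneTheory

variable {A : Type w}

theorem iter_mono (H : Set (Ops A)) (k : ℕ) : Monotone (iter A H k) :=
  monotone_nat_of_le_succ fun _ => Set.subset_union_right

theorem exists_eq_of_mem_iter {H : Set (Ops A)} {k n : ℕ} {op : Ops A}
    (h : op ∈ iter A H k n) : ∃ f, op = ⟨k, f⟩ := by
  induction n generalizing op with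
  | zero =>
    obtain ⟨i, rfl⟩ := h
    exact ⟨_, rfl⟩
  | succ n ih =>
    rcases h with ⟨a, m, f, g, -, hg, rfl⟩ | h
    · obtain ⟨_, hm⟩ := ih (hg 0)
      obtain rfl : m = k := congrArg Sigma.fst hm
      exact ⟨_, rfl⟩
    · exact ih h

theorem iter_comp {H : Set (Ops A)} {n m a b : ℕ} {f : (Fin (n + 1) → A) → A}
    {g : Fin (n + 1) → (Fin (m + 1) → A) → A} (hf : (⟨n, f⟩ : Ops A) ∈ iter A H n a)
    (hg : ∀ i, (⟨m, g i⟩ : Ops A) ∈ iter A H m b) :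
    (⟨m, fun x => f fun i => g i x⟩ : Ops A) ∈ iter A H m (a + b) := by
  induction a generalizing f with
  | zero =>
    obtain ⟨i, hi⟩ := hf
    obtain rfl := eq_of_heq (Sigma.mk.inj hi).2
    rw [Nat.zero_add]
    exact hg i
  | succ a ih =>
    rw [Nat.succ_add]
    rcases hf with ⟨l, n', f', g', hf', hg', heq⟩ | hf
    · obtain rfl : n = n' := congrArg Sigma.fst heq
      obtain rfl := eq_of_heq (Sigma.mk.inj heq).2
      exact Or.inl ⟨l, m, f', fun j x => g' j fun i => g i x, hf', fun j => ih (hg' j), rfl⟩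
    · exact Or.inr (ih hf)

theorem isClone_iUnion_iter (H : Set (Ops A)) :
    IsClone A {op : Ops A | ∃ n, op ∈ iter A H op.1 n} where
  proj n i := ⟨0, i, rfl⟩
  comp n m f g hf hg := by
    obtain ⟨a, ha⟩ := hf
    choose b hb using hg
    exact ⟨a + Finset.univ.sup b, iter_comp ha fun i =>
      iter_mono H m (Finset.le_sup (Finset.mem_univ i)) (hb i)⟩

theorem exists_mem_iter_of_mem_cloneGen {H : Set (Ops A)} {op : Ops A}
    (h : op ∈ cloneGen A H) : ∃ n, op ∈ iter A H op.1 n :=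
  Set.mem_sInter.1 h _ ⟨isClone_iUnion_iter H, fun op' hop' =>
    ⟨1, Or.inl ⟨op'.1, op'.1, op'.2, fun i x => x i, hop', fun i => ⟨i, rfl⟩, rfl⟩⟩⟩

theorem iter_subset {H F : Set (Ops A)} (hF : IsClone A F) (hH : H ⊆ F) (k n : ℕ) :
    iter A H k n ⊆ F := by
  induction n with
  | zero =>
    rintro _ ⟨i, rfl⟩
    exact hF.proj k i
  | succ n ih =>
    rintro _ (⟨a, m, f, g, hf, hg, rfl⟩ | h)
    · exact hF.comp a m f g (hH hf) fun i => ih (hg i)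
    · exact ih h

theorem iter_iterate {H : Set (Ops A)} {k m l : ℕ} {b : A → A} {g : (Fin (k + 1) → A) → A}
    (hb : (⟨0, fun x => b (x 0)⟩ : Ops A) ∈ iter A H 0 m)
    (hg : (⟨k, g⟩ : Ops A) ∈ iter A H k l) (n : ℕ) :
    (⟨k, fun x => b^[n] (g x)⟩ : Ops A) ∈ iter A H k (n * m + l) := by
  induction n with
  | zero => simpa using hg
  | succ n ih =>
    have h := iter_comp hb (g := fun _ => fun x => b^[n] (g x)) fun _ => ih
    simp only [Function.iterate_succ_apply']
    rwa [← add_assoc, add_comm m, ← Nat.succ_mul] at h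

theorem mk_mem_polSet {L : FirstOrder.Language.{u, v}} {M : Type w} [L.Structure M] {n : ℕ}
    {f : (Fin (n + 1) → M) → M} :
    (⟨n, f⟩ : Ops M) ∈ PolSet L M ↔ ∃ h : (Fin (n + 1) → M) →[L] M, ⇑h = f :=
  Iff.rfl

theorem isClone_polSet (L : FirstOrder.Language.{u, v}) (M : Type w) [L.Structure M] :
    IsClone M (PolSet L M) where
  proj n i := ⟨⟨fun x => x i, fun _ _ => rfl, fun _ _ h => h i⟩, rfl⟩
  comp n m f g := by
    simp only [mk_mem_polSet]
    rintro ⟨f', rfl⟩ hg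
    choose g' hg using hg
    obtain rfl : (fun i => ⇑(g' i)) = g := funext hg
    exact ⟨⟨fun x => f' fun i => g' i x,
      fun F x => by
        rw [← Function.comp_def]
        refine Eq.trans (congrArg f' (funext fun i => (g' i).map_fun F x)) ?_
        exact f'.map_fun F fun j i => g' i (x j),
      fun r x h => f'.map_rel r (fun j i => g' i (x j)) fun i => (g' i).map_rel r x h⟩, rfl⟩

theorem unary_mem_polSet {L : FirstOrder.Language.{u, v}} {M : Type w} [L.Structure M]
    (h : M →[L] M) : (⟨0, fun x => h (x 0)⟩ : Ops M) ∈ PolSet L M :=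
  ⟨⟨fun x => h (x 0), fun F x => h.map_fun F fun j => x j 0,
    fun r x hx => h.map_rel r (fun j => x j 0) (hx 0)⟩, rfl⟩

end CloneTheory

open UHomog CloneTheory FirstOrder FirstOrder.Language in
/-- Theorem: if `K` is a strict Fraïssé class closed under finite products, with the HAP, such
that the coproduct of countably many copies of the Fraïssé limit `U` exists in `(K̄,→)` and
`End U` is not finitely generated, then the polymorphism clone `Pol U` has the Bergman
property. -/
theorem statement17
    (L : FirstOrder.Language.{u, v})
    [Countable (Σ l, L.Functions l)] [Countable (Σ l, L.Relations l)]
    (K : Set (Bundled.{w} L.Structure)) (hK : IsStrictFraisse L K)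
    (U : Type w) [L.Structure U] [Countable U] (hU : IsFraisseLimit K U)
    (hprod : ∀ A B : Bundled.{w} L.Structure, A ∈ K → B ∈ K →
      (Bundled.of (↥A × ↥B) : Bundled.{w} L.Structure) ∈ K)
    (hhap : HAP L K)
    (hcoprod : CoproductOfCopiesExists L K U)
    (hend : ¬ EndFinitelyGenerated L U) :
    BergmanProperty U (PolSet L U) := by
  intro H hH hgen k
  by_contra! hne
  have hout : ∀ n, ∃ f : (Fin (k + 1) → U) →[L] U, (⟨k, f⟩ : Ops U) ∉ iter U H k n := by
    intro n
    by_contra! hall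
    refine hne n (Set.Subset.antisymm (fun op hop => ?_) ?_)
    · refine ⟨iter_subset (isClone_polSet L U) hH k n hop, ?_⟩
      obtain ⟨f, rfl⟩ := exists_eq_of_mem_iter hop
      rfl
    · rintro ⟨_, f⟩ ⟨hpol, rfl⟩
      obtain ⟨h, rfl⟩ := mk_mem_polSet.1 hpol
      exact hall h
  choose f hf using fun n => hout (n + (n * n + (n + n)))
  obtain ⟨e, he⟩ := exists_hom_forall_factor hK hU hhap
    (hU.inBar.pow hK.1.hereditary hprod k)
  choose g hg using fun n => he (f n)
  obtain ⟨a, b, c, habc⟩ := exists_hom_sequence_words hK hU hhap hcoprod g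
  have hmem : ∀ op ∈ PolSet L U, ∃ n, op ∈ iter U H op.1 n := fun op hop =>
    exists_mem_iter_of_mem_cloneGen (hgen.symm ▸ hop)
  obtain ⟨na, hna⟩ := hmem _ (unary_mem_polSet a)
  obtain ⟨nb, hnb⟩ := hmem _ (unary_mem_polSet b)
  obtain ⟨nc, hnc⟩ := hmem _ (unary_mem_polSet c)
  obtain ⟨ne, hne'⟩ := hmem ⟨k, e⟩ ⟨e, rfl⟩
  obtain ⟨n, hn⟩ : ∃ n, na ≤ n ∧ nb ≤ n ∧ nc ≤ n ∧ ne ≤ n :=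
    ⟨na + nb + nc + ne, by omega, by omega, by omega, by omega⟩
  have ha := iter_mono H 0 hn.1 hna
  have hb := iter_mono H 0 hn.2.1 hnb
  have hc := iter_mono H 0 hn.2.2.1 hnc
  have he' := iter_mono H k hn.2.2.2 hne'
  have h := iter_comp hc (g := fun _ => fun x => b^[n] (a (e x))) fun _ =>
    iter_iterate hb (iter_comp ha (g := fun _ => ⇑e) fun _ => he') n
  refine hf n ?_
  convert h using 2
  funext x
  rw [← hg n, Hom.comp_apply, habc]
end
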